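/- Let Λ ⊆ ℂ be a lattice, let s ∈ ℂ satisfy ns ∉ Λ for every integer n ≥ 1, and let t ∈ ℂ. The elliptic function f_t(z) := ζ_Λ(z−t) − ζ_Λ(z) is elliptically summable if and only if f_t vanishes identically on ℂ ∖ (Λ ∪ (t+Λ)). -/

import Mathlib

open Filter Topology Set

/-- The Weierstrass zeta function of a lattice `L ⊆ ℂ`. -/
noncomputable def wzeta (L : Set ℂ) (z : ℂ) : ℂ :=
  1 / z + ∑' l : ↥(L \ {0}), (1 / (z - (l : ℂ)) + 1 / (l : ℂ) + z / (l : ℂ) ^ 2)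

/-- `L` is a lattice in `ℂ`. -/
def IsLattice (L : Set ℂ) : Prop :=
  ∃ ω₁ ω₂ : ℂ, LinearIndependent ℝ ![ω₁, ω₂] ∧
    L = {z : ℂ | ∃ m n : ℤ, z = (m : ℂ) * ω₁ + (n : ℂ) * ω₂}

/-- `F` extends analytically to the point `α`. -/
def ExtAnalyticAt (F : ℂ → ℂ) (α : ℂ) : Prop :=
  ∃ g : ℂ → ℂ, AnalyticAt ℂ g α ∧ ∀ᶠ z in 𝓝[≠] α, F z = g z

/-- `f` is an elliptic function for the lattice `L`: meromorphic on `ℂ` and `L`-periodic. -/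
def IsElliptic (L : Set ℂ) (f : ℂ → ℂ) : Prop :=
  MeromorphicOn f Set.univ ∧
    ∀ lam ∈ L, ∀ z : ℂ, AnalyticAt ℂ f z → f (z + lam) = f z

/-- `c : ℕ → ℂ` is the family of principal part coefficients of `f` at `α`
(`c k` is the coefficient of `1/(z-α)^k`; `c 0` is irrelevant and set to `0`). -/
def IsPrincPart (f : ℂ → ℂ) (α : ℂ) (c : ℕ → ℂ) : Prop :=
  c 0 = 0 ∧ (Function.support c).Finite ∧
    ExtAnalyticAt (fun z => f z - ∑ᶠ k : ℕ, c k / (z - α) ^ k) α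

/-- `R` is a pinning: `(r, n, λ) ↦ r + n s + λ` is a bijection from `R × ℤ × L` onto `ℂ`. -/
def IsPinning (L : Set ℂ) (s : ℂ) (R : Set ℂ) : Prop :=
  ∀ z : ℂ, ∃! p : ℂ × ℤ × ℂ, p.1 ∈ R ∧ p.2.2 ∈ L ∧ z = p.1 + (p.2.1 : ℂ) * s + p.2.2


/-- `f` is elliptically summable: `f = τ(g) − g` for some elliptic `g`,
where `τ(g)(z) = g(z+s)`. -/
def EllSummable (L : Set ℂ) (s : ℂ) (f : ℂ → ℂ) : Prop :=
  ∃ g : ℂ → ℂ, IsElliptic L g ∧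
    ∀ z : ℂ, AnalyticAt ℂ g z → AnalyticAt ℂ g (z + s) → f z = g (z + s) - g z


namespace PeriodPair

/-- The summand of the Weierstrass zeta function at a lattice point `l`. -/
noncomputable def zetaSummand (l z : ℂ) : ℂ := 1 / (z - l) + 1 / l + z / l ^ 2

lemma zetaSummand_bound {r : ℝ} (hr : 0 < r) {z : ℂ} (hz : ‖z‖ < r) {l : ℂ} (h : 2 * r ≤ ‖l‖) :
    ‖zetaSummand l z‖ ≤ 2 * r ^ 2 * ‖l‖ ^ (-3 : ℝ) := by
  have hl : 0 < ‖l‖ := by linarith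
  have hl0 : l ≠ 0 := norm_pos_iff.mp hl
  have hzl : ‖l‖ / 2 ≤ ‖z - l‖ := by
    rw [norm_sub_rev]
    exact .trans (by linarith) (norm_sub_norm_le l z)
  have hzl0 : z - l ≠ 0 := norm_pos_iff.mp (by linarith)
  have e : zetaSummand l z = z ^ 2 / ((z - l) * l ^ 2) := by
    rw [zetaSummand]
    field_simp
    ring
  calc
    ‖zetaSummand l z‖ = ‖z‖ ^ 2 / (‖z - l‖ * ‖l‖ ^ 2) := by simp [e]
    _ ≤ r ^ 2 / (‖l‖ / 2 * ‖l‖ ^ 2) := by gcongr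
    _ = 2 * r ^ 2 / ‖l‖ ^ 3 := by field
    _ = _ := by norm_cast

lemma hasDerivAt_zetaSummand {l z : ℂ} (h : z ≠ l) :
    HasDerivAt (zetaSummand l) (-(1 / (z - l) ^ 2 - 1 / l ^ 2)) z := by
  have h1 := ((hasDerivAt_id z).sub_const l).inv (sub_ne_zero.mpr h)
  have h2 := (h1.add_const (1 / l)).add ((hasDerivAt_id z).div_const (l ^ 2))
  convert! h2 using 1
  · ext w
    simp [zetaSummand]
  · simp
    ring

lemma zetaSummand_neg (l z : ℂ) : zetaSummand (-l) (-z) = -zetaSummand l z := by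
  rw [zetaSummand, zetaSummand, show -z - -l = -(z - l) by ring]
  simp only [one_div, inv_neg, neg_sq, neg_div]
  ring

variable (Λ : PeriodPair)

/-- The Weierstrass zeta function with the `l₀`-term missing. -/
noncomputable def zetaExcept (l₀ z : ℂ) : ℂ :=
  ∑' l : Λ.lattice, if l.1 = l₀ then 0 else zetaSummand l z

lemma hasSumLocallyUniformly_zetaExcept (l₀ : ℂ) :
    HasSumLocallyUniformly
      (fun (l : Λ.lattice) (z : ℂ) ↦ if l.1 = l₀ then 0 else zetaSummand l z)
      (Λ.zetaExcept l₀) := by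
  refine Λ.hasSumLocallyUniformly_aux (u := fun r (l : Λ.lattice) ↦ 2 * r ^ 2 * ‖l‖ ^ (-3 : ℝ)) _
    (fun _ _ ↦ (ZLattice.summable_norm_rpow _ _ (by simp; norm_num)).mul_left _) fun r hr ↦
    Filter.eventually_atTop.mpr ⟨2 * r, ?_⟩
  rintro _ h z hz l rfl
  split_ifs
  · simp only [norm_zero]
    positivity
  · exact zetaSummand_bound hr hz h

lemma differentiableOn_zetaExcept_partialSum (l₀ : ℂ) (l : Λ.lattice) :
    DifferentiableOn ℂ (fun z ↦ if l.1 = l₀ then 0 else zetaSummand l z) (Λ.lattice \ {l₀})ᶜ := by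
  split_ifs with h
  · simp
  · intro z hz
    refine (hasDerivAt_zetaSummand ?_).differentiableAt.differentiableWithinAt
    rintro rfl
    exact hz ⟨l.2, h⟩

lemma differentiableOn_zetaExcept (l₀ : ℂ) :
    DifferentiableOn ℂ (Λ.zetaExcept l₀) (Λ.lattice \ {l₀})ᶜ :=
  (Λ.hasSumLocallyUniformly_zetaExcept l₀).hasSumLocallyUniformlyOn.differentiableOn
    (.of_forall fun _ ↦ .fun_sum fun l _ ↦ Λ.differentiableOn_zetaExcept_partialSum l₀ l)
    Λ.isOpen_compl_lattice_sdiff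

lemma eqOn_deriv_zetaExcept (l₀ : ℂ) :
    EqOn (deriv (Λ.zetaExcept l₀)) (fun z ↦ -Λ.weierstrassPExcept l₀ z) (Λ.lattice \ {l₀})ᶜ := by
  refine ((Λ.hasSumLocallyUniformly_zetaExcept l₀).tendstoLocallyUniformlyOn.deriv
    (.of_forall fun _ ↦ .fun_sum fun l _ ↦ Λ.differentiableOn_zetaExcept_partialSum l₀ l)
    Λ.isOpen_compl_lattice_sdiff).unique ?_
  refine (Λ.hasSumLocallyUniformly_weierstrassPExcept l₀).tendstoLocallyUniformlyOn.neg.congr ?_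
  intro s z hz
  have hd (l : Λ.lattice) : HasDerivAt (fun z ↦ if l.1 = l₀ then 0 else zetaSummand l z)
      (-if l.1 = l₀ then 0 else (1 / (z - l) ^ 2 - 1 / (l : ℂ) ^ 2)) z := by
    split_ifs with h
    · simpa using hasDerivAt_const z (0 : ℂ)
    · refine hasDerivAt_zetaSummand ?_
      rintro rfl
      exact hz ⟨l.2, h⟩
  have := (HasDerivAt.fun_sum (u := s) fun l _ ↦ hd l).deriv
  simp only [Function.comp_apply, Pi.neg_apply]
  rw [this, Finset.sum_neg_distrib]

lemma wzeta_eq_tsum (z : ℂ) : wzeta Λ.lattice z = ∑' l : Λ.lattice, zetaSummand l z := by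
  have hs : Summable fun l : Λ.lattice ↦ if l.1 = 0 then 0 else zetaSummand l z :=
    (Λ.hasSumLocallyUniformly_zetaExcept 0).hasSum.summable
  have hs' : Summable fun l : Λ.lattice ↦ if l = 0 then zetaSummand 0 z else 0 :=
    summable_of_hasFiniteSupport ((Set.finite_singleton (0 : Λ.lattice)).subset (by simp))
  have h1 : ∑' l : ↥((Λ.lattice : Set ℂ) \ {0}), zetaSummand l z =
      ∑' l : Λ.lattice, if l.1 = 0 then 0 else zetaSummand l z := by
    rw [tsum_subtype ((Λ.lattice : Set ℂ) \ {0}) (fun l ↦ zetaSummand l z)]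
    rw [show (∑' l : Λ.lattice, if l.1 = 0 then 0 else zetaSummand l z) =
      ∑' l : (Λ.lattice : Set ℂ), (fun l : ℂ ↦ if l = 0 then 0 else zetaSummand l z) l from rfl,
      tsum_subtype (Λ.lattice : Set ℂ) (fun l : ℂ ↦ if l = 0 then 0 else zetaSummand l z)]
    congr with l
    by_cases h : l ∈ Λ.lattice <;> by_cases h0 : l = 0 <;> simp [indicator, h, h0]
  have h2 : ∑' l : Λ.lattice, (if l = 0 then zetaSummand 0 z else 0) = 1 / z := by
    simp [zetaSummand]
  unfold wzeta
  rw [← h2]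
  change _ + ∑' l : ↥((Λ.lattice : Set ℂ) \ {0}), zetaSummand l z = _
  rw [h1, ← hs'.tsum_add hs]
  congr with l
  by_cases h : l = 0 <;> simp [h]

lemma zetaExcept_add (l₀ : Λ.lattice) (z : ℂ) :
    Λ.zetaExcept l₀ z + zetaSummand l₀ z = wzeta Λ.lattice z := by
  have hs : Summable fun l : Λ.lattice ↦ if l.1 = l₀.1 then 0 else zetaSummand l z :=
    (Λ.hasSumLocallyUniformly_zetaExcept l₀).hasSum.summable
  have hs' : Summable fun l : Λ.lattice ↦ if l = l₀ then zetaSummand l₀ z else 0 :=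
    summable_of_hasFiniteSupport ((Set.finite_singleton l₀).subset (by simp))
  have h2 : ∑' l : Λ.lattice, (if l = l₀ then zetaSummand l₀ z else 0) = zetaSummand l₀ z := by
    simp
  rw [wzeta_eq_tsum, zetaExcept, ← h2, ← hs.tsum_add hs']
  congr with l
  by_cases h : l = l₀ <;> simp [h]

lemma zetaExcept_of_notMem {l₀ : ℂ} (h : l₀ ∉ Λ.lattice) :
    Λ.zetaExcept l₀ = wzeta Λ.lattice := by
  ext z
  have h1 (l : Λ.lattice) : l.1 ≠ l₀ := fun e ↦ h (e ▸ l.2)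
  simp [wzeta_eq_tsum, zetaExcept, h1]

lemma wzeta_neg (z : ℂ) : wzeta Λ.lattice (-z) = -wzeta Λ.lattice z := by
  rw [wzeta_eq_tsum, wzeta_eq_tsum, ← (Equiv.neg Λ.lattice).tsum_eq, ← tsum_neg]
  congr with l
  exact zetaSummand_neg l z

lemma differentiableOn_wzeta : DifferentiableOn ℂ (wzeta Λ.lattice) (Λ.lattice : Set ℂ)ᶜ := by
  have h := Λ.ω₁_div_two_notMem_lattice
  rw [← Λ.zetaExcept_of_notMem h]
  convert! Λ.differentiableOn_zetaExcept _
  simp [h]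

lemma deriv_wzeta {z : ℂ} (hz : z ∉ Λ.lattice) :
    deriv (wzeta Λ.lattice) z = -Λ.weierstrassP z := by
  have h := Λ.ω₁_div_two_notMem_lattice
  rw [← Λ.zetaExcept_of_notMem h, ← Λ.weierstrassPExcept_of_notMem _ h]
  exact Λ.eqOn_deriv_zetaExcept _ (by simp [hz])

lemma analyticAt_wzeta {z : ℂ} (hz : z ∉ Λ.lattice) : AnalyticAt ℂ (wzeta Λ.lattice) z :=
  Λ.differentiableOn_wzeta.analyticOnNhd Λ.isClosed_lattice.isOpen_compl z hz

lemma isPreconnected_compl_lattice : IsPreconnected (Λ.lattice : Set ℂ)ᶜ :=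
  (Set.Countable.isConnected_compl_of_one_lt_rank (by simp)
    (countable_of_Lindelof_of_discrete (X := Λ.lattice))).2

lemma add_coe_mem_lattice_iff {z : ℂ} (l : Λ.lattice) : z + l ∈ Λ.lattice ↔ z ∈ Λ.lattice :=
  Submodule.add_mem_iff_left _ l.2

/-- The quasi-period of the Weierstrass zeta function. -/
lemma exists_wzeta_add (l : Λ.lattice) :
    ∃ η : ℂ, ∀ z ∉ Λ.lattice, wzeta Λ.lattice (z + l) = wzeta Λ.lattice z + η := by
  have hmem {z : ℂ} (hz : z ∉ Λ.lattice) : z + l ∉ Λ.lattice :=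
    (Λ.add_coe_mem_lattice_iff l).not.mpr hz
  have hd {z : ℂ} (hz : z ∉ Λ.lattice) : HasDerivAt
      (fun z ↦ wzeta Λ.lattice (z + l) - wzeta Λ.lattice z) 0 z := by
    have h1 := (Λ.analyticAt_wzeta (hmem hz)).differentiableAt.hasDerivAt.comp_add_const z l
    have h2 := (Λ.analyticAt_wzeta hz).differentiableAt.hasDerivAt
    convert! h1.sub h2 using 1
    rw [deriv_wzeta _ (hmem hz), deriv_wzeta _ hz, weierstrassP_add_coe, sub_self]
  obtain ⟨η, hη⟩ := Λ.isClosed_lattice.isOpen_compl.exists_is_const_of_deriv_eq_zero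
    Λ.isPreconnected_compl_lattice
    (fun z hz ↦ (hd hz).differentiableAt.differentiableWithinAt) (fun z hz ↦ (hd hz).deriv)
  exact ⟨η, fun z hz ↦ by rw [← hη z hz]; ring⟩

lemma meromorphicOrderAt_wzeta {z : ℂ} (hz : z ∈ Λ.lattice) :
    meromorphicOrderAt (wzeta Λ.lattice) z = -1 := by
  have hE : AnalyticAt ℂ (Λ.zetaExcept z) z :=
    (Λ.differentiableOn_zetaExcept z).analyticOnNhd Λ.isOpen_compl_lattice_sdiff z (by simp)
  have hA : AnalyticAt ℂ
      (fun w ↦ 1 + (w - z) * (Λ.zetaExcept z w + (1 / z + w / z ^ 2))) z := by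
    simp only [div_eq_mul_inv]
    fun_prop
  have hev : (fun w ↦ (w - z) ^ (-1 : ℤ) •
      (1 + (w - z) * (Λ.zetaExcept z w + (1 / z + w / z ^ 2)))) =ᶠ[𝓝[≠] z] wzeta Λ.lattice := by
    filter_upwards [self_mem_nhdsWithin] with w hw
    have hw' : w - z ≠ 0 := sub_ne_zero.mpr hw
    rw [← Λ.zetaExcept_add ⟨z, hz⟩ w, zetaSummand, zpow_neg_one, smul_eq_mul, mul_add,
      inv_mul_cancel_left₀ hw']
    ring
  have hm : MeromorphicAt (wzeta Λ.lattice) z :=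
    MeromorphicAt.congr (by fun_prop) hev
  exact (meromorphicOrderAt_eq_int_iff hm).mpr ⟨_, hA, by simp, hev.symm⟩

lemma meromorphicAt_wzeta (z : ℂ) : MeromorphicAt (wzeta Λ.lattice) z := by
  by_cases hz : z ∈ Λ.lattice
  · exact meromorphicAt_of_meromorphicOrderAt_ne_zero (by simp [Λ.meromorphicOrderAt_wzeta hz])
  · exact (Λ.analyticAt_wzeta hz).meromorphicAt

lemma exists_norm_add_coe_le : ∃ R : ℝ, ∀ z : ℂ, ∃ l : Λ.lattice, ‖z + l‖ ≤ R := by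
  have hmem (z : ℂ) : (ZSpan.floor Λ.basis z : ℂ) ∈ Λ.lattice := by
    rw [Λ.lattice_eq_span_range_basis]
    exact (ZSpan.floor Λ.basis z).2
  refine ⟨∑ i, ‖Λ.basis i‖, fun z ↦ ⟨-⟨ZSpan.floor Λ.basis z, hmem z⟩, ?_⟩⟩
  simpa [ZSpan.fract_apply, sub_eq_add_neg] using ZSpan.norm_fract_le Λ.basis z

/-- Liouville's theorem for functions periodic with respect to a lattice. -/
lemma exists_eq_const_of_periodic {F : ℂ → ℂ} (hF : Differentiable ℂ F)
    (hp : ∀ (l : Λ.lattice) (z : ℂ), F (z + l) = F z) : ∃ c, ∀ z, F z = c := by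
  obtain ⟨R, hR⟩ := Λ.exists_norm_add_coe_le
  refine ⟨F 0, fun z ↦ hF.apply_eq_apply_of_bounded ?_ z 0⟩
  refine ((isCompact_closedBall (0 : ℂ) R).image hF.continuous).isBounded.subset ?_
  rintro _ ⟨z, rfl⟩
  obtain ⟨l, hl⟩ := hR z
  exact ⟨z + l, by simpa using hl, hp l z⟩

lemma eventually_notMem_lattice (z : ℂ) : ∀ᶠ w in 𝓝[≠] z, w ∉ Λ.lattice := by
  filter_upwards [mem_nhdsWithin_of_mem_nhds (Λ.compl_lattice_sdiff_singleton_mem_nhds z),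
    self_mem_nhdsWithin] with w hw hwz hwL
  exact hw ⟨hwL, hwz⟩

end PeriodPair

lemma tendsto_add_const_nhdsNE (a c : ℂ) : Tendsto (fun z ↦ z + c) (𝓝[≠] a) (𝓝[≠] (a + c)) :=
  tendsto_nhdsWithin_of_tendsto_nhds_of_eventually_within _
    ((continuous_add_const c).continuousAt.tendsto.mono_left nhdsWithin_le_nhds)
    (by filter_upwards [self_mem_nhdsWithin] with z hz using by simpa using hz)

lemma exists_differentiable_of_meromorphicOrderAt_nonneg {F : ℂ → ℂ} (hF : MeromorphicOn F univ)
    (h : ∀ z, 0 ≤ meromorphicOrderAt F z) :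
    ∃ H : ℂ → ℂ, Differentiable ℂ H ∧ ∀ z, F =ᶠ[𝓝[≠] z] H := by
  refine ⟨toMeromorphicNFOn F univ, fun z ↦ ?_,
    fun z ↦ (hF.toMeromorphicNFOn_eq_self_on_nhdsNE (mem_univ z)).symm⟩
  refine AnalyticAt.differentiableAt ?_
  rw [← (meromorphicNFOn_toMeromorphicNFOn F univ (mem_univ z)
    ).meromorphicOrderAt_nonneg_iff_analyticAt]
  rw [meromorphicOrderAt_toMeromorphicNFOn hF (mem_univ z)]
  exact h z

lemma meromorphicOrderAt_neg_of_eventuallyEq_add {F₁ F₂ e : ℂ → ℂ} {a : ℂ}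
    (h : F₂ =ᶠ[𝓝[≠] a] F₁ + e) (he : MeromorphicAt e a) (he' : 0 ≤ meromorphicOrderAt e a)
    (hF : meromorphicOrderAt F₁ a < 0) : meromorphicOrderAt F₂ a < 0 := by
  rwa [meromorphicOrderAt_congr h, meromorphicOrderAt_add_eq_left_of_lt he (hF.trans_le he')]

lemma Continuous.eq_of_eventuallyEq_nhdsNE {F G : ℂ → ℂ} (hF : Continuous F) (hG : Continuous G)
    {a : ℂ} (h : F =ᶠ[𝓝[≠] a] G) : F a = G a :=
  ((hF.continuousAt.eventuallyEq_nhds_iff_eventuallyEq_nhdsNE hG.continuousAt).mp h).eq_of_nhds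

namespace PeriodPair

variable (Λ : PeriodPair)

lemma not_forall_meromorphicOrderAt_neg {F : ℂ → ℂ} (hF : MeromorphicOn F univ)
    (hp : ∀ (l : Λ.lattice) (z : ℂ), meromorphicOrderAt F z < 0 → meromorphicOrderAt F (z + l) < 0)
    {s : ℂ} (hs : ∀ n : ℕ, 1 ≤ n → (n : ℂ) * s ∉ Λ.lattice) (a : ℂ) :
    ¬ ∀ n : ℕ, meromorphicOrderAt F (a + n * s) < 0 := by
  intro h
  obtain ⟨R, hR⟩ := Λ.exists_norm_add_coe_le
  choose l hl using fun n : ℕ ↦ hR (a + n * s)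
  have hne {m n : ℕ} (hmn : m < n) : a + m * s + l m ≠ a + n * s + l n := by
    intro e
    apply hs (n - m) (by omega)
    rw [Nat.cast_sub hmn.le, show ((n : ℂ) - m) * s = l m - l n by linear_combination -e]
    exact sub_mem (l m).2 (l n).2
  have hinj : Function.Injective fun n : ℕ ↦ a + n * s + l n := by
    intro m n e
    by_contra hmn
    rcases lt_or_gt_of_ne hmn with hmn | hmn
    exacts [hne hmn e, hne hmn e.symm]
  obtain ⟨x, -, hx⟩ := (Set.infinite_range_of_injective hinj).exists_accPt_of_subset_isCompact
    (isCompact_closedBall (0 : ℂ) R) (by rintro _ ⟨n, rfl⟩; simpa using hl n)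
  obtain ⟨y, ⟨n, rfl⟩, hy⟩ := ((accPt_iff_frequently_nhdsNE.mp hx).and_eventually
    (hF x (mem_univ x)).eventually_analyticAt).exists
  exact (hp (l n) _ (h n)).not_ge hy.meromorphicOrderAt_nonneg

lemma exists_eventuallyEq_affine {G : ℂ → ℂ} (hG : MeromorphicOn G univ) {s : ℂ}
    (hs : ∀ n : ℕ, 1 ≤ n → (n : ℂ) * s ∉ Λ.lattice)
    (hGs : ∃ c : ℂ, ∀ a, (fun z ↦ G (z + s)) =ᶠ[𝓝[≠] a] fun z ↦ G z + c)
    (hGl : ∀ l : Λ.lattice, ∃ c : ℂ, ∀ a, (fun z ↦ G (z + l)) =ᶠ[𝓝[≠] a] fun z ↦ G z + c) :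
    ∃ A B : ℂ, ∀ a, G =ᶠ[𝓝[≠] a] fun z ↦ A * z + B := by
  have key (w : ℂ) (hw : ∃ c : ℂ, ∀ a, (fun z ↦ G (z + w)) =ᶠ[𝓝[≠] a] fun z ↦ G z + c) (z : ℂ)
      (hz : meromorphicOrderAt G z < 0) : meromorphicOrderAt G (z + w) < 0 := by
    obtain ⟨c, hc⟩ := hw
    rw [← meromorphicOrderAt_fun_comp_add_const_eq_meromorphicOrderAt]
    have hcst : AnalyticAt ℂ (fun _ : ℂ ↦ c) z := analyticAt_const
    exact meromorphicOrderAt_neg_of_eventuallyEq_add (hc z) hcst.meromorphicAt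
      hcst.meromorphicOrderAt_nonneg hz
  have hpole (a : ℂ) : 0 ≤ meromorphicOrderAt G a := by
    by_contra! ha
    refine Λ.not_forall_meromorphicOrderAt_neg hG (fun l ↦ key l (hGl l)) hs a fun n ↦ ?_
    induction n with
    | zero => simpa using ha
    | succ n ih =>
      convert! key s hGs _ ih using 2
      push_cast
      ring
  obtain ⟨H, hH, hGH⟩ := exists_differentiable_of_meromorphicOrderAt_nonneg hG hpole
  have hHl (l : Λ.lattice) : ∃ c : ℂ, ∀ z, H (z + l) = H z + c := by
    obtain ⟨c, hc⟩ := hGl l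
    refine ⟨c, fun z ↦ ?_⟩
    refine Continuous.eq_of_eventuallyEq_nhdsNE (F := fun z ↦ H (z + l)) (G := fun z ↦ H z + c)
      (hH.continuous.comp (continuous_add_const _)) (hH.continuous.add_const _) ?_
    filter_upwards [hc z, hGH z, (tendsto_add_const_nhdsNE z l).eventually (hGH (z + l))]
      with w h1 h2 h3
    rw [← h3, h1, h2]
  obtain ⟨A, hA⟩ := Λ.exists_eq_const_of_periodic (F := deriv H)
    (hH.contDiff (n := 2)).differentiable_deriv_two fun l z ↦ by
      obtain ⟨c, hc⟩ := hHl l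
      rw [← deriv_comp_add_const, funext hc, deriv_add_const]
  have hd (z : ℂ) : HasDerivAt (fun z ↦ H z - A * z) 0 z := by
    convert! (hH z).hasDerivAt.sub ((hasDerivAt_id z).const_mul A) using 1
    simp [hA]
  have hconst (z : ℂ) : H z - A * z = H 0 - A * 0 :=
    is_const_of_deriv_eq_zero (fun z ↦ (hd z).differentiableAt) (fun z ↦ (hd z).deriv) z 0
  refine ⟨A, H 0, fun a ↦ (hGH a).trans (.of_forall fun z ↦ ?_)⟩
  linear_combination hconst z

/-- The quasi-periods of the Weierstrass zeta function are not `ℂ`-linear in the period. -/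
lemma not_exists_wzeta_add_eq_mul :
    ¬ ∃ a : ℂ, ∀ (l : Λ.lattice), ∀ z ∉ Λ.lattice,
      wzeta Λ.lattice (z + l) = wzeta Λ.lattice z + a * l := by
  rintro ⟨a, ha⟩
  set φ : ℂ → ℂ := fun z ↦ wzeta Λ.lattice z - a * z with hφ
  have hper (l : Λ.lattice) (z : ℂ) (hz : z ∉ Λ.lattice) : φ (z + l) = φ z := by
    simp only [hφ, ha l z hz]
    ring
  have hneg (z : ℂ) : φ (-z) = -φ z := by
    simp only [hφ, wzeta_neg]
    ring
  have han {z : ℂ} (hz : z ∉ Λ.lattice) : AnalyticAt ℂ φ z :=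
    (Λ.analyticAt_wzeta hz).sub (by fun_prop)
  have hmer (z : ℂ) : MeromorphicAt φ z := (Λ.meromorphicAt_wzeta z).sub (by fun_prop)
  have hord {z : ℂ} (hz : z ∈ Λ.lattice) : meromorphicOrderAt φ z = -1 := by
    have hlin : AnalyticAt ℂ (fun z ↦ -(a * z)) z := by fun_prop
    have := meromorphicOrderAt_add_eq_left_of_lt (f₁ := wzeta Λ.lattice) hlin.meromorphicAt
      (lt_of_lt_of_le (by rw [Λ.meromorphicOrderAt_wzeta hz]; decide) hlin.meromorphicOrderAt_nonneg)
    rw [← Λ.meromorphicOrderAt_wzeta hz, ← this]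
    congr 1
  have hzero {z : ℂ} (hz : z ∉ Λ.lattice) (h2 : 2 * z ∈ Λ.lattice) : φ z = 0 := by
    have h1 := hper ⟨2 * z, h2⟩ (-z) (by simpa using hz)
    rw [hneg, show -z + 2 * z = z by ring] at h1
    linear_combination h1 / 2
  have hpos {z : ℂ} (hz : z ∉ Λ.lattice) (h2 : 2 * z ∈ Λ.lattice) :
      1 ≤ meromorphicOrderAt φ z := by
    have : 0 < meromorphicOrderAt φ z := by
      rw [← tendsto_zero_iff_meromorphicOrderAt_pos (hmer z), ← hzero hz h2]
      exact (han hz).continuousAt.tendsto.mono_left nhdsWithin_le_nhds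
    cases h : meromorphicOrderAt φ z with
    | top => exact le_top
    | coe n =>
      rw [h] at this
      exact_mod_cast Int.add_one_le_of_lt (WithTop.coe_pos.mp this)
  set w := Λ.ω₁ / 2 with hw
  have hwL : w ∉ Λ.lattice := Λ.ω₁_div_two_notMem_lattice
  have h2w : 2 * w ∈ Λ.lattice := by simpa [hw, mul_div_cancel₀] using Λ.ω₁_mem_lattice
  set K : ℂ → ℂ := fun z ↦ φ z * φ (z + w) with hK
  have hmer' (z : ℂ) : MeromorphicAt (fun z ↦ φ (z + w)) z :=
    (hmer (z + w)).comp_analyticAt (f := φ) (g := fun z ↦ z + w) (by fun_prop)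
  have hKord (z : ℂ) :
      meromorphicOrderAt K z = meromorphicOrderAt φ z + meromorphicOrderAt φ (z + w) := by
    rw [← meromorphicOrderAt_fun_comp_add_const_eq_meromorphicOrderAt (x := z)]
    exact meromorphicOrderAt_mul (hmer z) (hmer' z)
  have hKnonneg (z : ℂ) : 0 ≤ meromorphicOrderAt K z := by
    rw [hKord]
    by_cases hz : z ∈ Λ.lattice
    · have h1 : z + w ∉ Λ.lattice := (Submodule.add_mem_iff_right _ hz).not.mpr hwL
      have h2 : 2 * (z + w) ∈ Λ.lattice := by
        rw [mul_add, two_mul z]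
        exact add_mem (add_mem hz hz) h2w
      rw [hord hz]
      exact le_trans (by decide) (add_le_add_right (hpos h1 h2) (-1))
    by_cases hzw : z + w ∈ Λ.lattice
    · have h2 : 2 * z ∈ Λ.lattice := by
        rw [show 2 * z = (z + w) + (z + w) - 2 * w by ring]
        exact sub_mem (add_mem hzw hzw) h2w
      rw [hord hzw]
      exact le_trans (by decide) (add_le_add_left (hpos hz h2) (-1))
    · exact add_nonneg (han hz).meromorphicOrderAt_nonneg (han hzw).meromorphicOrderAt_nonneg
  obtain ⟨H, hH, hKH⟩ := exists_differentiable_of_meromorphicOrderAt_nonneg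
    (fun z _ ↦ (hmer z).mul (hmer' z)) hKnonneg
  obtain ⟨c, hc⟩ := Λ.exists_eq_const_of_periodic hH fun l z ↦ by
    refine Continuous.eq_of_eventuallyEq_nhdsNE (F := fun z ↦ H (z + l))
      (hH.continuous.comp (continuous_add_const _)) hH.continuous ?_
    filter_upwards [hKH z, (tendsto_add_const_nhdsNE z l).eventually (hKH (z + l)),
      Λ.eventually_notMem_lattice z,
      (tendsto_add_const_nhdsNE z w).eventually (Λ.eventually_notMem_lattice (z + w))]
      with u h1 h2 h3 h4
    rw [← h1, ← h2]
    simp only [Pi.mul_apply]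
    rw [hper l u h3, show u + l + w = u + w + l by ring, hper l (u + w) h4]
  set v := Λ.ω₂ / 2 with hv
  have hvL : v ∉ Λ.lattice := Λ.ω₂_div_two_notMem_lattice
  have h2v : 2 * v ∈ Λ.lattice := by simpa [hv, mul_div_cancel₀] using Λ.ω₂_mem_lattice
  have hvwL : v + w ∉ Λ.lattice := by
    have := (Λ.mul_ω₁_add_mul_ω₂_mem_lattice (α := 1 / 2) (β := 1 / 2)).not.mpr (by norm_num)
    convert! this using 2
    push_cast
    rw [hv, hw]
    ring
  have hKv : AnalyticAt ℂ K v :=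
    (han hvL).mul (AnalyticAt.fun_comp (f := fun z ↦ z + w) (han hvwL) (by fun_prop))
  have hc0 : c = 0 := by
    have := ((hKv.continuousAt.eventuallyEq_nhds_iff_eventuallyEq_nhdsNE
      hH.continuous.continuousAt).mp (hKH v)).eq_of_nhds
    rw [← hc v, ← this, hK]
    simp [hzero hvL h2v]
  have htop : meromorphicOrderAt K 0 = ⊤ := by
    rw [meromorphicOrderAt_eq_top_iff]
    filter_upwards [hKH 0] with z hz
    rw [hK, ← hc0, ← hc z, ← hz]
    rfl
  have hφ0 : meromorphicOrderAt φ 0 ≠ ⊤ := by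
    rw [hord (zero_mem _)]
    decide
  have hφw : meromorphicOrderAt φ (0 + w) ≠ ⊤ :=
    MeromorphicOn.meromorphicOrderAt_ne_top_of_isPreconnected (fun z _ ↦ hmer z)
      isPreconnected_univ (mem_univ 0) (mem_univ _) hφ0
  rw [hKord, WithTop.add_eq_top] at htop
  exact htop.elim hφ0 hφw

lemma exists_telescope_wzeta (s : ℂ) (n : ℤ) :
    ∃ h : ℂ → ℂ, MeromorphicOn h univ ∧
      (∀ z, h (z + s) - h z = wzeta Λ.lattice (z - n * s) - wzeta Λ.lattice z) ∧
      ∀ (l : Λ.lattice) (η : ℂ),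
        (∀ z ∉ Λ.lattice, wzeta Λ.lattice (z + l) = wzeta Λ.lattice z + η) →
        ∀ a, ∀ᶠ z in 𝓝[≠] a, h (z + l) = h z - n * η := by
  have hmer (c z : ℂ) : MeromorphicAt (fun z ↦ wzeta Λ.lattice (z - c)) z :=
    (Λ.meromorphicAt_wzeta (z - c)).comp_analyticAt (g := fun z ↦ z - c) (by fun_prop)
  have hev (c a : ℂ) : ∀ᶠ z in 𝓝[≠] a, z - c ∉ Λ.lattice := by
    simpa only [sub_eq_add_neg] using (tendsto_add_const_nhdsNE a (-c)).eventually
      (Λ.eventually_notMem_lattice (a + -c))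
  induction n with
  | zero => exact ⟨0, fun z _ ↦ analyticAt_const.meromorphicAt, by simp, by simp⟩
  | succ n ih =>
    obtain ⟨h, hm, hs, hl⟩ := ih
    refine ⟨fun z ↦ h z - wzeta Λ.lattice (z - (n + 1) * s),
      fun z hz ↦ (hm z hz).sub (hmer _ z), fun z ↦ ?_, fun l η hη a ↦ ?_⟩
    · have := hs z
      beta_reduce
      rw [show z + s - (n + 1) * s = z - n * s by ring]
      push_cast at this ⊢
      linear_combination this
    · filter_upwards [hl l η hη a, hev ((n + 1) * s) a] with z h1 h2
      rw [add_sub_right_comm, hη _ h2, h1]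
      push_cast
      ring
  | pred n ih =>
    obtain ⟨h, hm, hs, hl⟩ := ih
    refine ⟨fun z ↦ h z + wzeta Λ.lattice (z - (-n) * s),
      fun z hz ↦ (hm z hz).add (hmer _ z), fun z ↦ ?_, fun l η hη a ↦ ?_⟩
    · have := hs z
      beta_reduce
      rw [show z + s - (-n) * s = z - (-n - 1) * s by ring]
      push_cast at this ⊢
      linear_combination this
    · filter_upwards [hl l η hη a, hev ((-n) * s) a] with z h1 h2
      rw [add_sub_right_comm, hη _ h2, h1]
      push_cast
      ring

/-- If `wzeta (z - t) - wzeta z` is the difference `g (z + s) - g z` of an elliptic function `g`,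
up to a discrete set, then `t` lies in `ℤ s + Λ`. -/
lemma exists_eq_int_mul_add_of_summable {s t : ℂ}
    (hs : ∀ n : ℕ, 1 ≤ n → (n : ℂ) * s ∉ Λ.lattice) {g : ℂ → ℂ} (hg : MeromorphicOn g univ)
    (hgl : ∀ (l : Λ.lattice) a, (fun z ↦ g (z + l)) =ᶠ[𝓝[≠] a] g)
    (hgs : ∀ a, ∀ᶠ z in 𝓝[≠] a, wzeta Λ.lattice (z - t) - wzeta Λ.lattice z = g (z + s) - g z) :
    ∃ (n : ℤ) (l : Λ.lattice), t = n * s + l := by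
  by_contra! ht
  set f : ℂ → ℂ := fun z ↦ wzeta Λ.lattice (z - t) - wzeta Λ.lattice z with hf
  have hsZ {n : ℤ} (hn : n ≠ 0) : (n : ℂ) * s ∉ Λ.lattice := by
    intro h
    obtain ⟨m, rfl | rfl⟩ := n.eq_nat_or_neg
    · exact hs m (by omega) (by simpa using h)
    · exact hs m (by omega) (by simpa using h)
  have hst (n : ℤ) : (n : ℂ) * s - t ∉ Λ.lattice := by
    intro h
    refine ht n (-⟨_, h⟩) ?_
    simp
  have hsub {x : ℂ} (hx : x - t ∉ Λ.lattice) :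
      AnalyticAt ℂ (fun z ↦ wzeta Λ.lattice (z - t)) x :=
    AnalyticAt.fun_comp (f := fun z ↦ z - t) (Λ.analyticAt_wzeta hx) (by fun_prop)
  have hfan {n : ℤ} (hn : n ≠ 0) : AnalyticAt ℂ f (n * s) :=
    (hsub (hst n)).sub (Λ.analyticAt_wzeta (hsZ hn))
  have hf0 : meromorphicOrderAt f 0 < 0 := by
    have h0 : AnalyticAt ℂ (fun z ↦ wzeta Λ.lattice (z - t)) 0 := hsub (by simpa using hst 0)
    refine meromorphicOrderAt_neg_of_eventuallyEq_add (F₁ := -wzeta Λ.lattice) ?_ h0.meromorphicAt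
      h0.meromorphicOrderAt_nonneg ?_
    · exact .of_forall fun z ↦ by simp [hf]; ring
    · rw [← meromorphicOrderAt_neg, Λ.meromorphicOrderAt_wzeta (zero_mem _)]
      decide
  have hper (l : Λ.lattice) (z : ℂ) (hz : meromorphicOrderAt g z < 0) :
      meromorphicOrderAt g (z + l) < 0 := by
    rwa [← meromorphicOrderAt_fun_comp_add_const_eq_meromorphicOrderAt,
      meromorphicOrderAt_congr (hgl l z)]
  have hgτ : MeromorphicOn (fun z ↦ g (z + s)) univ := fun z _ ↦
    (hg (z + s) (mem_univ _)).comp_analyticAt (f := g) (g := fun z ↦ z + s) (by fun_prop)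
  by_cases h1 : meromorphicOrderAt g s < 0
  · refine Λ.not_forall_meromorphicOrderAt_neg hg hper hs s fun n ↦ ?_
    induction n with
    | zero => simpa using h1
    | succ n ih =>
      have han : AnalyticAt ℂ f (s + n * s) := by
        convert! hfan (n := n + 1) (by omega) using 1
        push_cast
        ring
      rw [show s + (n + 1 : ℕ) * s = s + n * s + s by push_cast; ring,
        ← meromorphicOrderAt_fun_comp_add_const_eq_meromorphicOrderAt]
      refine meromorphicOrderAt_neg_of_eventuallyEq_add ?_ han.meromorphicAt
        han.meromorphicOrderAt_nonneg ih
      filter_upwards [hgs (s + n * s)] with z hz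
      simp [hf, hz]
  · refine Λ.not_forall_meromorphicOrderAt_neg hg hper (s := -s)
      (fun n hn h ↦ hs n hn (by simpa using h)) 0 fun n ↦ ?_
    induction n with
    | zero =>
      rw [Nat.cast_zero, zero_mul, add_zero, meromorphicOrderAt_neg]
      refine meromorphicOrderAt_neg_of_eventuallyEq_add (F₁ := f) (e := -fun z ↦ g (z + s))
        ?_ (hgτ 0 (mem_univ 0)).neg ?_ hf0
      · filter_upwards [hgs 0] with z hz
        simp [hf, hz]
        ring
      · rw [← meromorphicOrderAt_neg, meromorphicOrderAt_fun_comp_add_const_eq_meromorphicOrderAt,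
          zero_add]
        exact not_lt.mp h1
    | succ n ih =>
      have han : AnalyticAt ℂ (-f) (0 + (n + 1 : ℕ) * -s) := by
        convert! (hfan (n := -(n + 1)) (by omega)).neg using 1
        push_cast
        ring
      refine meromorphicOrderAt_neg_of_eventuallyEq_add (F₁ := fun z ↦ g (z + s)) ?_
        han.meromorphicAt han.meromorphicOrderAt_nonneg ?_
      · filter_upwards [hgs (0 + (n + 1 : ℕ) * -s)] with z hz
        simp [hf, hz]
      · rw [meromorphicOrderAt_fun_comp_add_const_eq_meromorphicOrderAt]
        convert! ih using 2
        push_cast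
        ring

lemma wzeta_sub_eq_zero_of_summable {s t : ℂ}
    (hs : ∀ n : ℕ, 1 ≤ n → (n : ℂ) * s ∉ Λ.lattice) {g : ℂ → ℂ} (hg : MeromorphicOn g univ)
    (hgl : ∀ (l : Λ.lattice) a, (fun z ↦ g (z + l)) =ᶠ[𝓝[≠] a] g)
    (hgs : ∀ a, ∀ᶠ z in 𝓝[≠] a, wzeta Λ.lattice (z - t) - wzeta Λ.lattice z = g (z + s) - g z)
    {z : ℂ} (hz : z ∉ Λ.lattice) : wzeta Λ.lattice (z - t) - wzeta Λ.lattice z = 0 := by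
  obtain ⟨n, l, rfl⟩ := Λ.exists_eq_int_mul_add_of_summable hs hg hgl hgs
  obtain ⟨h, hm, hhs, hhl⟩ := Λ.exists_telescope_wzeta s n
  obtain ⟨η, hη⟩ := Λ.exists_wzeta_add l
  have hη' {w : ℂ} (hw : w ∉ Λ.lattice) : wzeta Λ.lattice (w - l) = wzeta Λ.lattice w - η := by
    have := hη (w - l) ((Submodule.sub_mem_iff_left _ l.2).not.mpr hw)
    rw [sub_add_cancel] at this
    rw [this, add_sub_cancel_right]
  have hGs (a : ℂ) : (fun z ↦ (g - h) (z + s)) =ᶠ[𝓝[≠] a] fun z ↦ (g - h) z + -η := by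
    filter_upwards [hgs a, (tendsto_add_const_nhdsNE a (-(n * s))).eventually
      (Λ.eventually_notMem_lattice (a + -(n * s)))] with w h1 h2
    have h3 := hη' h2
    rw [← sub_eq_add_neg, sub_sub] at h3
    simp only [Pi.sub_apply]
    linear_combination h3 - h1 - hhs w
  have hGl (l' : Λ.lattice) (η' : ℂ)
      (h' : ∀ z ∉ Λ.lattice, wzeta Λ.lattice (z + l') = wzeta Λ.lattice z + η') (a : ℂ) :
      (fun z ↦ (g - h) (z + l')) =ᶠ[𝓝[≠] a] fun z ↦ (g - h) z + n * η' := by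
    filter_upwards [hgl l' a, hhl l' η' h' a] with w h1 h2
    simp only [Pi.sub_apply, h1, h2]
    ring
  obtain ⟨A, B, hAB⟩ := Λ.exists_eventuallyEq_affine (hg.sub hm) hs ⟨-η, hGs⟩ fun l' ↦ by
    obtain ⟨η', h'⟩ := Λ.exists_wzeta_add l'
    exact ⟨n * η', hGl l' η' h'⟩
  have hslope {w c : ℂ} (hw : (fun z ↦ (g - h) (z + w)) =ᶠ[𝓝[≠] 0] fun z ↦ (g - h) z + c) :
      A * w = c := by
    obtain ⟨u, h1, h2, h3⟩ := (hw.and ((hAB 0).and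
      ((tendsto_add_const_nhdsNE 0 w).eventually (hAB (0 + w))))).exists
    beta_reduce at h1 h2 h3
    rw [h2, h3] at h1
    linear_combination h1
  have hn : n = 0 := by
    by_contra hn
    refine Λ.not_exists_wzeta_add_eq_mul ⟨A / n, fun l' w hw ↦ ?_⟩
    obtain ⟨η', h'⟩ := Λ.exists_wzeta_add l'
    have hn' : (n : ℂ) ≠ 0 := by exact_mod_cast hn
    rw [h' w hw, div_mul_eq_mul_div, hslope (hGl l' η' h' 0), mul_div_cancel_left₀ _ hn']
  subst hn
  have hA : A = 0 := by
    obtain ⟨η', h'⟩ := Λ.exists_wzeta_add ⟨Λ.ω₁, Λ.ω₁_mem_lattice⟩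
    have := hslope (hGl _ η' h' 0)
    have hω : Λ.ω₁ ≠ 0 := Λ.indep.ne_zero 0
    simpa [hω] using this
  have hη0 : η = 0 := by simpa [hA] using hslope (hGs 0)
  simpa [hη0, sub_eq_zero] using hη' hz

end PeriodPair

theorem stmt5 (L : Set ℂ) (hL : IsLattice L) (s : ℂ)
    (hs : ∀ n : ℕ, 1 ≤ n → (n : ℂ) * s ∉ L) (t : ℂ) :
    EllSummable L s (fun z => wzeta L (z - t) - wzeta L z) ↔
      ∀ z : ℂ, z ∉ L → (∀ lam ∈ L, z ≠ t + lam) →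
        wzeta L (z - t) - wzeta L z = 0 := by
  obtain ⟨ω₁, ω₂, hω, rfl⟩ := hL
  set Λ : PeriodPair := ⟨ω₁, ω₂, hω⟩
  have hΛ : {z : ℂ | ∃ m n : ℤ, z = (m : ℂ) * ω₁ + (n : ℂ) * ω₂} = (Λ.lattice : Set ℂ) := by
    ext z
    simp only [mem_ofPred_eq, SetLike.mem_coe, PeriodPair.mem_lattice, eq_comm (b := z)]
    rfl
  rw [hΛ] at hs ⊢
  constructor
  · rintro ⟨g, ⟨hg, hgl⟩, hgs⟩ z hz -
    have han (a : ℂ) : ∀ᶠ z in 𝓝[≠] a, AnalyticAt ℂ g z := (hg a (mem_univ a)).eventually_analyticAt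
    refine Λ.wzeta_sub_eq_zero_of_summable hs hg (fun l a ↦ ?_) (fun a ↦ ?_) hz
    · filter_upwards [han a] with z hz using hgl l l.2 z hz
    · filter_upwards [han a, (tendsto_add_const_nhdsNE a s).eventually (han (a + s))]
        with z h1 h2 using hgs z h1 h2
  · intro h
    set S : Set ℂ := {z | z ∈ Λ.lattice ∨ z - t ∈ Λ.lattice} with hS
    have hev (a : ℂ) : ∀ᶠ z in 𝓝[≠] a, S.indicator 1 z = (0 : ℂ) := by
      filter_upwards [Λ.eventually_notMem_lattice a, (tendsto_add_const_nhdsNE a (-t)).eventually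
        (Λ.eventually_notMem_lattice (a + -t))] with z h1 h2
      refine indicator_of_notMem ?_ _
      rintro (h | h)
      exacts [h1 h, h2 (by rwa [← sub_eq_add_neg])]
    have hna {z : ℂ} (hz : AnalyticAt ℂ (S.indicator (1 : ℂ → ℂ)) z) : z ∉ S := by
      intro hzS
      have := ((hz.continuousAt.eventuallyEq_nhds_iff_eventuallyEq_nhdsNE
        (continuousAt_const (y := (0 : ℂ)))).mp (hev z)).eq_of_nhds
      simp [hzS] at this
    refine ⟨S.indicator 1, ⟨fun a _ ↦ ?_, fun l hl z hz ↦ ?_⟩, fun z hz hzs ↦ ?_⟩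
    · exact (analyticAt_const (v := (0 : ℂ))).meromorphicAt.congr ((hev a).mono fun _ h ↦ h.symm)
    · have hzl : z + l ∉ S := by
        rintro (h | h)
        · exact hna hz (.inl ((Submodule.add_mem_iff_left _ hl).mp h))
        · rw [add_sub_right_comm] at h
          exact hna hz (.inr ((Submodule.add_mem_iff_left _ hl).mp h))
      rw [indicator_of_notMem hzl, indicator_of_notMem (hna hz)]
    · rw [indicator_of_notMem (hna hz), indicator_of_notMem (hna hzs), sub_zero]
      refine h z (fun h ↦ hna hz (.inl h)) fun l hl e ↦ hna hz (.inr ?_)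
      simpa [e] using hl
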